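/- Formalized Σ₁-completeness theorem for modal arithmetic: for every Σ₁ formula φ of the language of arithmetic, PA(K) proves φ → □φ. -/

import Mathlib

namespace ModalArith

/-- Terms of the language of arithmetic L_A = {0, S, +, ×, ≤, =}. -/
inductive Term : Type
  | var : ℕ → Term
  | zero : Term
  | succ : Term → Term
  | add : Term → Term → Term
  | mul : Term → Term → Term
  deriving DecidableEq

namespace Term

/-- Free variables of a term. -/
def fv : Term → Finset ℕ
  | var x => {x}
  | zero => ∅
  | succ t => fv t
  | add t u => fv t ∪ fv u
  | mul t u => fv t ∪ fv u

/-- Simultaneous substitution of terms for variables. -/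
def substAll : Term → (ℕ → Term) → Term
  | var x, v => v x
  | zero, _ => zero
  | succ t, v => succ (substAll t v)
  | add t u, v => add (substAll t v) (substAll u v)
  | mul t u, v => mul (substAll t v) (substAll u v)

/-- Substitution of the term `s` for the variable `x`. -/
def subst (x : ℕ) (s : Term) (t : Term) : Term :=
  substAll t (Function.update Term.var x s)

/-- The numeral `n̄`. -/
def numeral : ℕ → Term
  | 0 => zero
  | n + 1 => succ (numeral n)

/-- Value of a term in the standard model under a valuation. -/
def val : Term → (ℕ → ℕ) → ℕ
  | var x, v => v x
  | zero, _ => 0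
  | succ t, v => val t v + 1
  | add t u, v => val t v + val u v
  | mul t u, v => val t v * val u v

/-- A Gödel numbering of terms. -/
def code : Term → ℕ
  | var x => Nat.pair 0 x
  | zero => Nat.pair 1 0
  | succ t => Nat.pair 2 (code t)
  | add t u => Nat.pair 3 (Nat.pair (code t) (code u))
  | mul t u => Nat.pair 4 (Nat.pair (code t) (code u))

end Term

/-- Formulas of the language L_□ of modal arithmetic. -/
inductive Formula : Type
  | falsum : Formula
  | eq : Term → Term → Formula
  | le : Term → Term → Formula
  | and : Formula → Formula → Formula
  | or : Formula → Formula → Formula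
  | imp : Formula → Formula → Formula
  | neg : Formula → Formula
  | all : ℕ → Formula → Formula
  | ex : ℕ → Formula → Formula
  | box : Formula → Formula
  deriving DecidableEq

namespace Formula

/-- Free variables of a formula. -/
def fv : Formula → Finset ℕ
  | falsum => ∅
  | eq t u => t.fv ∪ u.fv
  | le t u => t.fv ∪ u.fv
  | and φ ψ => fv φ ∪ fv ψ
  | or φ ψ => fv φ ∪ fv ψ
  | imp φ ψ => fv φ ∪ fv ψ
  | neg φ => fv φ
  | all x φ => (fv φ).erase x
  | ex x φ => (fv φ).erase x
  | box φ => fv φ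

/-- Simultaneous substitution of terms for the free variables of a formula. -/
def substAll : Formula → (ℕ → Term) → Formula
  | falsum, _ => falsum
  | eq t u, v => eq (t.substAll v) (u.substAll v)
  | le t u, v => le (t.substAll v) (u.substAll v)
  | and φ ψ, v => and (substAll φ v) (substAll ψ v)
  | or φ ψ, v => or (substAll φ v) (substAll ψ v)
  | imp φ ψ, v => imp (substAll φ v) (substAll ψ v)
  | neg φ, v => neg (substAll φ v)
  | all x φ, v => all x (substAll φ (Function.update v x (Term.var x)))
  | ex x φ, v => ex x (substAll φ (Function.update v x (Term.var x)))
  | box φ, v => box (substAll φ v)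

/-- Substitution of the term `s` for the free occurrences of the variable `x`. -/
def subst (x : ℕ) (s : Term) (φ : Formula) : Formula :=
  substAll φ (Function.update Term.var x s)

/-- The term `s` is substitutable (free) for the variable `x` in the formula. -/
def freeFor (s : Term) (x : ℕ) : Formula → Prop
  | falsum => True
  | eq _ _ => True
  | le _ _ => True
  | and φ ψ => freeFor s x φ ∧ freeFor s x ψ
  | or φ ψ => freeFor s x φ ∧ freeFor s x ψ
  | imp φ ψ => freeFor s x φ ∧ freeFor s x ψ
  | neg φ => freeFor s x φ
  | all y φ => x = y ∨ x ∉ fv φ ∨ (y ∉ s.fv ∧ freeFor s x φ)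
  | ex y φ => x = y ∨ x ∉ fv φ ∨ (y ∉ s.fv ∧ freeFor s x φ)
  | box φ => freeFor s x φ

/-- The formula is an L_A-formula (contains no □). -/
def noBox : Formula → Prop
  | falsum => True
  | eq _ _ => True
  | le _ _ => True
  | and φ ψ => noBox φ ∧ noBox ψ
  | or φ ψ => noBox φ ∧ noBox ψ
  | imp φ ψ => noBox φ ∧ noBox ψ
  | neg φ => noBox φ
  | all _ φ => noBox φ
  | ex _ φ => noBox φ
  | box _ => False

/-- Truth in the standard model ℕ under a valuation (meaningful for L_A-formulas;
boxed formulas are given the dummy value `False`). -/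
def val : Formula → (ℕ → ℕ) → Prop
  | falsum, _ => False
  | eq t u, v => t.val v = u.val v
  | le t u, v => t.val v ≤ u.val v
  | and φ ψ, v => val φ v ∧ val ψ v
  | or φ ψ, v => val φ v ∨ val ψ v
  | imp φ ψ, v => val φ v → val ψ v
  | neg φ, v => ¬ val φ v
  | all x φ, v => ∀ n : ℕ, val φ (Function.update v x n)
  | ex x φ, v => ∃ n : ℕ, val φ (Function.update v x n)
  | box _, _ => False

/-- Biconditional, as an abbreviation. -/
def iff (φ ψ : Formula) : Formula := (φ.imp ψ).and (ψ.imp φ)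

/-- `t < u` abbreviates `S t ≤ u`. -/
def lt (t u : Term) : Formula := le (Term.succ t) u

/-- Bounded universal quantification `∀ x < t, φ`. -/
def ball (x : ℕ) (t : Term) (φ : Formula) : Formula :=
  all x ((lt (Term.var x) t).imp φ)

/-- Bounded existential quantification `∃ x < t, φ`. -/
def bex (x : ℕ) (t : Term) (φ : Formula) : Formula :=
  ex x ((lt (Term.var x) t).and φ)

/-- A Gödel numbering of formulas. -/
def code : Formula → ℕ
  | falsum => Nat.pair 0 0
  | eq t u => Nat.pair 1 (Nat.pair t.code u.code)
  | le t u => Nat.pair 2 (Nat.pair t.code u.code)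
  | and φ ψ => Nat.pair 3 (Nat.pair (code φ) (code ψ))
  | or φ ψ => Nat.pair 4 (Nat.pair (code φ) (code ψ))
  | imp φ ψ => Nat.pair 5 (Nat.pair (code φ) (code ψ))
  | neg φ => Nat.pair 6 (code φ)
  | all x φ => Nat.pair 7 (Nat.pair x (code φ))
  | ex x φ => Nat.pair 8 (Nat.pair x (code φ))
  | box φ => Nat.pair 9 (code φ)

end Formula

/-- A sentence is a formula with no free variables. -/
def Sentence (φ : Formula) : Prop := φ.fv = ∅

/-- Truth in the standard model ℕ (for sentences; any fixed valuation will do). -/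
def StdTrue (φ : Formula) : Prop := φ.val fun _ => 0

/-- The logical axioms of classical first-order logic with equality for L_□,
with the identity axioms only for atomic formulas. -/
inductive LogicalAxiom : Formula → Prop
  | imp1 (φ ψ : Formula) : LogicalAxiom (φ.imp (ψ.imp φ))
  | imp2 (φ ψ χ : Formula) :
      LogicalAxiom ((φ.imp (ψ.imp χ)).imp ((φ.imp ψ).imp (φ.imp χ)))
  | dne (φ : Formula) : LogicalAxiom (φ.neg.neg.imp φ)
  | negI (φ ψ : Formula) : LogicalAxiom ((φ.imp ψ).imp ((φ.imp ψ.neg).imp φ.neg))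
  | negE (φ ψ : Formula) : LogicalAxiom (φ.neg.imp (φ.imp ψ))
  | falsumE (φ : Formula) : LogicalAxiom (Formula.falsum.imp φ)
  | negIntro (φ : Formula) : LogicalAxiom ((φ.imp Formula.falsum).imp φ.neg)
  | negElimFalsum (φ : Formula) : LogicalAxiom (φ.neg.imp (φ.imp Formula.falsum))
  | andI (φ ψ : Formula) : LogicalAxiom (φ.imp (ψ.imp (φ.and ψ)))
  | andE1 (φ ψ : Formula) : LogicalAxiom ((φ.and ψ).imp φ)
  | andE2 (φ ψ : Formula) : LogicalAxiom ((φ.and ψ).imp ψ)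
  | orI1 (φ ψ : Formula) : LogicalAxiom (φ.imp (φ.or ψ))
  | orI2 (φ ψ : Formula) : LogicalAxiom (ψ.imp (φ.or ψ))
  | orE (φ ψ χ : Formula) :
      LogicalAxiom ((φ.imp χ).imp ((ψ.imp χ).imp ((φ.or ψ).imp χ)))
  | allE (x : ℕ) (t : Term) (φ : Formula) :
      φ.freeFor t x → LogicalAxiom ((Formula.all x φ).imp (φ.subst x t))
  | allImp (x : ℕ) (φ ψ : Formula) :
      x ∉ φ.fv → LogicalAxiom ((Formula.all x (φ.imp ψ)).imp (φ.imp (Formula.all x ψ)))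
  | exI (x : ℕ) (t : Term) (φ : Formula) :
      φ.freeFor t x → LogicalAxiom ((φ.subst x t).imp (Formula.ex x φ))
  | exE (x : ℕ) (φ ψ : Formula) :
      x ∉ ψ.fv → LogicalAxiom ((Formula.all x (φ.imp ψ)).imp ((Formula.ex x φ).imp ψ))
  | eqRefl (t : Term) : LogicalAxiom (Formula.eq t t)
  | eqSymm (t u : Term) : LogicalAxiom ((Formula.eq t u).imp (Formula.eq u t))
  | eqTrans (t u w : Term) :
      LogicalAxiom ((Formula.eq t u).imp ((Formula.eq u w).imp (Formula.eq t w)))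
  | eqSucc (t u : Term) :
      LogicalAxiom ((Formula.eq t u).imp (Formula.eq t.succ u.succ))
  | eqAdd (t₁ t₂ u₁ u₂ : Term) :
      LogicalAxiom ((Formula.eq t₁ t₂).imp ((Formula.eq u₁ u₂).imp
        (Formula.eq (t₁.add u₁) (t₂.add u₂))))
  | eqMul (t₁ t₂ u₁ u₂ : Term) :
      LogicalAxiom ((Formula.eq t₁ t₂).imp ((Formula.eq u₁ u₂).imp
        (Formula.eq (t₁.mul u₁) (t₂.mul u₂))))
  | eqLe (t₁ t₂ u₁ u₂ : Term) :
      LogicalAxiom ((Formula.eq t₁ t₂).imp ((Formula.eq u₁ u₂).imp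
        ((Formula.le t₁ u₁).imp (Formula.le t₂ u₂))))

/-- Provability in an L_□-theory: logical axioms, the axioms of the theory, and the
rules modus ponens, generalization, and necessitation. -/
inductive Provable (T : Set Formula) : Formula → Prop
  | ax {φ : Formula} : φ ∈ T → Provable T φ
  | logic {φ : Formula} : LogicalAxiom φ → Provable T φ
  | mp {φ ψ : Formula} : Provable T (φ.imp ψ) → Provable T φ → Provable T ψ
  | gen {φ : Formula} (x : ℕ) : Provable T φ → Provable T (Formula.all x φ)
  | nec {φ : Formula} : Provable T φ → Provable T (Formula.box φ)

/-- First-order provability (no necessitation rule); used for the non-modal theory PA. -/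
inductive FOProvable (T : Set Formula) : Formula → Prop
  | ax {φ : Formula} : φ ∈ T → FOProvable T φ
  | logic {φ : Formula} : LogicalAxiom φ → FOProvable T φ
  | mp {φ ψ : Formula} : FOProvable T (φ.imp ψ) → FOProvable T φ → FOProvable T ψ
  | gen {φ : Formula} (x : ℕ) : FOProvable T φ → FOProvable T (Formula.all x φ)

/-- Basic (Robinson-style) axioms of arithmetic. -/
def succNeZero : Formula := (Formula.eq (Term.succ (Term.var 0)) Term.zero).neg
def succInj : Formula :=
  (Formula.eq (Term.succ (Term.var 0)) (Term.succ (Term.var 1))).imp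
    (Formula.eq (Term.var 0) (Term.var 1))
def addZero : Formula := Formula.eq (Term.add (Term.var 0) Term.zero) (Term.var 0)
def addSucc : Formula :=
  Formula.eq (Term.add (Term.var 0) (Term.succ (Term.var 1)))
    (Term.succ (Term.add (Term.var 0) (Term.var 1)))
def mulZero : Formula := Formula.eq (Term.mul (Term.var 0) Term.zero) Term.zero
def mulSucc : Formula :=
  Formula.eq (Term.mul (Term.var 0) (Term.succ (Term.var 1)))
    (Term.add (Term.mul (Term.var 0) (Term.var 1)) (Term.var 0))
def leDef : Formula :=
  (Formula.le (Term.var 0) (Term.var 1)).iff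
    (Formula.ex 2 (Formula.eq (Term.add (Term.var 0) (Term.var 2)) (Term.var 1)))

def baseAxioms : Set Formula :=
  {succNeZero, succInj, addZero, addSucc, mulZero, mulSucc, leDef}

/-- The induction axiom for the formula `φ` and the variable `x`. -/
def inductionAx (x : ℕ) (φ : Formula) : Formula :=
  ((φ.subst x Term.zero).and
    (Formula.all x (φ.imp (φ.subst x (Term.succ (Term.var x)))))).imp
      (Formula.all x φ)

/-- Peano arithmetic PA: basic axioms plus induction for L_A-formulas. -/
def PA : Set Formula :=
  baseAxioms ∪ {χ | ∃ (x : ℕ) (φ : Formula), φ.noBox ∧ χ = inductionAx x φ}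

/-- PA_□ : basic axioms plus induction for all L_□-formulas. -/
def PABox : Set Formula :=
  baseAxioms ∪ {χ | ∃ (x : ℕ) (φ : Formula), χ = inductionAx x φ}

/-- The distribution axiom K. -/
def axK (φ ψ : Formula) : Formula :=
  (Formula.box (φ.imp ψ)).imp ((Formula.box φ).imp (Formula.box ψ))

/-- PA(K). -/
def PAK : Set Formula := PABox ∪ {χ | ∃ φ ψ : Formula, χ = axK φ ψ}

/-- The axiom 4. -/
def ax4 (φ : Formula) : Formula := (Formula.box φ).imp (Formula.box (Formula.box φ))

/-- PA(K4). -/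
def PAK4 : Set Formula := PAK ∪ {χ | ∃ φ : Formula, χ = ax4 φ}

/-- The axiom of Triv. -/
def axTriv (φ : Formula) : Formula := (Formula.box φ).iff φ

/-- PA(Triv). -/
def PATriv : Set Formula := PAK ∪ {χ | ∃ φ : Formula, χ = axTriv φ}

/-- PA(Ver). -/
def PAVer : Set Formula := PAK ∪ {Formula.box Formula.falsum}

/-- `T` extends `U`: every axiom of `U` is provable in `T`. -/
def Extends (T U : Set Formula) : Prop := ∀ φ ∈ U, Provable T φ

/-- Consistency. -/
def Consistent (T : Set Formula) : Prop := ¬ Provable T Formula.falsum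

/-- The class Δ₀ of bounded L_A-formulas. -/
inductive IsDelta0 : Formula → Prop
  | falsum : IsDelta0 Formula.falsum
  | eq (t u : Term) : IsDelta0 (Formula.eq t u)
  | le (t u : Term) : IsDelta0 (Formula.le t u)
  | and {φ ψ : Formula} : IsDelta0 φ → IsDelta0 ψ → IsDelta0 (φ.and ψ)
  | or {φ ψ : Formula} : IsDelta0 φ → IsDelta0 ψ → IsDelta0 (φ.or ψ)
  | imp {φ ψ : Formula} : IsDelta0 φ → IsDelta0 ψ → IsDelta0 (φ.imp ψ)
  | neg {φ : Formula} : IsDelta0 φ → IsDelta0 φ.neg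
  | ball {x : ℕ} {t : Term} {φ : Formula} :
      x ∉ t.fv → IsDelta0 φ → IsDelta0 (Formula.ball x t φ)
  | bex {x : ℕ} {t : Term} {φ : Formula} :
      x ∉ t.fv → IsDelta0 φ → IsDelta0 (Formula.bex x t φ)

/-- The class Σ₁ of L_A-formulas. -/
inductive IsSigma1 : Formula → Prop
  | delta0 {φ : Formula} : IsDelta0 φ → IsSigma1 φ
  | and {φ ψ : Formula} : IsSigma1 φ → IsSigma1 ψ → IsSigma1 (φ.and ψ)
  | or {φ ψ : Formula} : IsSigma1 φ → IsSigma1 ψ → IsSigma1 (φ.or ψ)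
  | ex {x : ℕ} {φ : Formula} : IsSigma1 φ → IsSigma1 (Formula.ex x φ)
  | ball {x : ℕ} {t : Term} {φ : Formula} :
      x ∉ t.fv → IsSigma1 φ → IsSigma1 (Formula.ball x t φ)

/-- The class B of boxed formulas. -/
def IsB (φ : Formula) : Prop := ∃ ψ : Formula, φ = Formula.box ψ

/-- The class ΔB. -/
inductive IsDeltaB : Formula → Prop
  | delta0 {φ : Formula} : IsDelta0 φ → IsDeltaB φ
  | b (ψ : Formula) : IsDeltaB (Formula.box ψ)
  | and {φ ψ : Formula} : IsDeltaB φ → IsDeltaB ψ → IsDeltaB (φ.and ψ)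
  | or {φ ψ : Formula} : IsDeltaB φ → IsDeltaB ψ → IsDeltaB (φ.or ψ)
  | ball {x : ℕ} {t : Term} {φ : Formula} :
      x ∉ t.fv → IsDeltaB φ → IsDeltaB (Formula.ball x t φ)
  | bex {x : ℕ} {t : Term} {φ : Formula} :
      x ∉ t.fv → IsDeltaB φ → IsDeltaB (Formula.bex x t φ)

/-- The class ΣB. -/
inductive IsSigmaB : Formula → Prop
  | sigma1 {φ : Formula} : IsSigma1 φ → IsSigmaB φ
  | b (ψ : Formula) : IsSigmaB (Formula.box ψ)
  | and {φ ψ : Formula} : IsSigmaB φ → IsSigmaB ψ → IsSigmaB (φ.and ψ)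
  | or {φ ψ : Formula} : IsSigmaB φ → IsSigmaB ψ → IsSigmaB (φ.or ψ)
  | ex {x : ℕ} {φ : Formula} : IsSigmaB φ → IsSigmaB (Formula.ex x φ)
  | ball {x : ℕ} {t : Term} {φ : Formula} :
      x ∉ t.fv → IsSigmaB φ → IsSigmaB (Formula.ball x t φ)

/-- Iterated disjunction (the empty disjunction is ⊥). -/
def disj : List Formula → Formula
  | [] => Formula.falsum
  | [φ] => φ
  | φ :: ψ :: l => φ.or (disj (ψ :: l))

/-- Iterated conjunction (the empty conjunction is ⊤). -/
def conj : List Formula → Formula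
  | [] => Formula.falsum.neg
  | [φ] => φ
  | φ :: ψ :: l => φ.and (conj (ψ :: l))

/-- Γ-disjunction property. -/
def HasDP (T : Set Formula) (Γ : Formula → Prop) : Prop :=
  ∀ φ ψ : Formula, Γ φ → Γ ψ → Sentence φ → Sentence ψ →
    Provable T (φ.or ψ) → Provable T φ ∨ Provable T ψ

/-- (Γ, Θ)-disjunction property. -/
def HasDP2 (T : Set Formula) (Γ Θ : Formula → Prop) : Prop :=
  ∀ φ ψ : Formula, Γ φ → Θ ψ → Sentence φ → Sentence ψ →
    Provable T (φ.or ψ) → Provable T φ ∨ Provable T ψ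

/-- Γ-existence property. -/
def HasEP (T : Set Formula) (Γ : Formula → Prop) : Prop :=
  ∀ (x : ℕ) (φ : Formula), Γ φ → φ.fv ⊆ {x} →
    Provable T (Formula.ex x φ) → ∃ n : ℕ, Provable T (φ.subst x (Term.numeral n))

/-- Modal disjunction property. -/
def HasMDP (T : Set Formula) : Prop :=
  ∀ φ ψ : Formula, Sentence φ → Sentence ψ →
    Provable T ((Formula.box φ).or (Formula.box ψ)) → Provable T φ ∨ Provable T ψ

/-- Modal existence property. -/
def HasMEP (T : Set Formula) : Prop :=
  ∀ (x : ℕ) (φ : Formula), φ.fv ⊆ {x} →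
    Provable T (Formula.ex x (Formula.box φ)) →
      ∃ n : ℕ, Provable T (φ.subst x (Term.numeral n))

/-- n-fold B-disjunction property. -/
def HasBnDP (T : Set Formula) (n : ℕ) : Prop :=
  ∀ φ : Fin n → Formula, (∀ i, Sentence (φ i)) →
    Provable T (disj (List.ofFn fun i => Formula.box (φ i))) →
    ∃ i, Provable T (Formula.box (φ i))

/-- Σ₁-soundness. -/
def Sigma1Sound (T : Set Formula) : Prop :=
  ∀ φ : Formula, IsSigma1 φ → Sentence φ → Provable T φ → StdTrue φ

/-- L_A-soundness. -/
def LASound (T : Set Formula) : Prop :=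
  ∀ φ : Formula, φ.noBox → Sentence φ → Provable T φ → StdTrue φ

/-- `T` is recursively enumerable (via the Gödel numbering of formulas). -/
def RE (T : Set Formula) : Prop :=
  Nat.Partrec fun n => Part.assert (∃ φ ∈ T, Formula.code φ = n) fun _ => Part.some 0

/-- A fixed natural Σ₁ provability predicate `Pr_T(x)` for the theory `T`:
a Σ₁ L_A-formula with only the free variable `0` which numerates provability in `T`
in the standard model and satisfies the standard derivability conditions
(provably in PA). -/
structure ProvPred (T : Set Formula) where
  pr : Formula
  noBox : pr.noBox
  sigma1 : IsSigma1 pr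
  fvSub : pr.fv ⊆ {0}
  numerates : ∀ φ : Formula,
    StdTrue (pr.subst 0 (Term.numeral φ.code)) ↔ Provable T φ
  d1 : ∀ φ : Formula, Provable T φ → FOProvable PA (pr.subst 0 (Term.numeral φ.code))
  d2 : ∀ φ ψ : Formula,
    FOProvable PA ((pr.subst 0 (Term.numeral (φ.imp ψ).code)).imp
      ((pr.subst 0 (Term.numeral φ.code)).imp (pr.subst 0 (Term.numeral ψ.code))))
  necClosed : ∀ φ : Formula,
    FOProvable PA ((pr.subst 0 (Term.numeral φ.code)).imp
      (pr.subst 0 (Term.numeral (Formula.box φ).code)))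

/-- `Pr_T(⌜φ⌝)`. -/
def ProvPred.app {T : Set Formula} (P : ProvPred T) (φ : Formula) : Formula :=
  P.pr.subst 0 (Term.numeral φ.code)

/-- Γ-disjunctive correctness (Γ-DC). -/
def DC (T : Set Formula) (P : ProvPred T) (Γ : Formula → Prop) : Prop :=
  ∀ φ : Formula, Γ φ → Sentence φ → Provable T (φ.or (P.app φ)) → Provable T φ

/-- The substitution replacing each variable by the numeral of its value. -/
def numeralSubst (v : ℕ → ℕ) : ℕ → Term := fun x => Term.numeral (v x)

/-- Standard-model satisfaction of the ρ_T-translation: `ρ_T` is the identity on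
L_A-formulas, commutes with connectives and quantifiers, and sends `□φ(x⃗)` to
`Pr_T(⌜□φ(ẋ⃗)⌝)`, whose truth in ℕ (for a natural provability predicate) amounts to
provability in `T` of `□φ(n̄⃗)`. -/
def RhoSat (T : Set Formula) : Formula → (ℕ → ℕ) → Prop
  | .falsum, _ => False
  | .eq t u, v => t.val v = u.val v
  | .le t u, v => t.val v ≤ u.val v
  | .and φ ψ, v => RhoSat T φ v ∧ RhoSat T ψ v
  | .or φ ψ, v => RhoSat T φ v ∨ RhoSat T ψ v
  | .imp φ ψ, v => RhoSat T φ v → RhoSat T ψ v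
  | .neg φ, v => ¬ RhoSat T φ v
  | .all x φ, v => ∀ n : ℕ, RhoSat T φ (Function.update v x n)
  | .ex x φ, v => ∃ n : ℕ, RhoSat T φ (Function.update v x n)
  | .box φ, v => Provable T (Formula.box (φ.substAll (numeralSubst v)))

/-- Standard-model satisfaction of the π_T-translation: `π_T` is the identity on
L_A-formulas, commutes with connectives and quantifiers, and sends `□φ(x⃗)` to
`Pr_T(⌜φ(ẋ⃗)⌝)`, whose truth in ℕ (for a natural provability predicate) amounts to
provability in `T` of `φ(n̄⃗)`. -/
def PiSat (T : Set Formula) : Formula → (ℕ → ℕ) → Prop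
  | .falsum, _ => False
  | .eq t u, v => t.val v = u.val v
  | .le t u, v => t.val v ≤ u.val v
  | .and φ ψ, v => PiSat T φ v ∧ PiSat T ψ v
  | .or φ ψ, v => PiSat T φ v ∨ PiSat T ψ v
  | .imp φ ψ, v => PiSat T φ v → PiSat T ψ v
  | .neg φ, v => ¬ PiSat T φ v
  | .all x φ, v => ∀ n : ℕ, PiSat T φ (Function.update v x n)
  | .ex x φ, v => ∃ n : ℕ, PiSat T φ (Function.update v x n)
  | .box φ, v => Provable T (φ.substAll (numeralSubst v))

/-- Weak ΣB-soundness: every provable ΣB sentence is true in ℕ under ρ_T. -/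
def WeaklySigmaBSound (T : Set Formula) : Prop :=
  ∀ φ : Formula, IsSigmaB φ → Sentence φ → Provable T φ → RhoSat T φ fun _ => 0

/-- ΣB-soundness: every provable ΣB sentence is true in ℕ under π_T. -/
def SigmaBSound (T : Set Formula) : Prop :=
  ∀ φ : Formula, IsSigmaB φ → Sentence φ → Provable T φ → PiSat T φ fun _ => 0

end ModalArith

namespace ModalArith

open Term Formula

/-- Provability in PA(K). -/
abbrev Pv (φ : Formula) : Prop := Provable PAK φ

/-- Deductively closed sets of formulas. -/
structure IsTh (F : Set Formula) : Prop where
  thm : ∀ φ, Pv φ → φ ∈ F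
  mp : ∀ φ ψ, φ.imp ψ ∈ F → φ ∈ F → ψ ∈ F

/-- Propositionally maximal theories. -/
structure MT where
  S : Formula → Prop
  thm : ∀ {φ}, Pv φ → S φ
  imp : ∀ φ ψ, S (φ.imp ψ) ↔ (S φ → S ψ)
  and : ∀ φ ψ, S (φ.and ψ) ↔ (S φ ∧ S ψ)
  or : ∀ φ ψ, S (φ.or ψ) ↔ (S φ ∨ S ψ)
  neg : ∀ φ, S φ.neg ↔ ¬ S φ
  falsum : ¬ S Formula.falsum

attribute [simp] MT.imp MT.and MT.or MT.neg MT.falsum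

@[simp] theorem MT.iff (M : MT) (φ ψ : Formula) : M.S (φ.iff ψ) ↔ (M.S φ ↔ M.S ψ) := by
  simp [Formula.iff]; tauto

theorem IsTh.lg {F : Set Formula} (h : IsTh F) {φ : Formula} (l : LogicalAxiom φ) : φ ∈ F :=
  h.thm _ (.logic l)

theorem IsTh.exten {F : Set Formula} (h : IsTh F) (ψ : Formula) : IsTh {χ | ψ.imp χ ∈ F} where
  thm χ hχ := h.mp _ _ (h.lg (.imp1 χ ψ)) (h.thm _ hχ)
  mp χ θ h1 h2 := h.mp _ _ (h.mp _ _ (h.lg (.imp2 ψ χ θ)) h1) h2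

theorem exists_max (φ : Formula) (hφ : ¬ Pv φ) :
    ∃ F : Set Formula, IsTh F ∧ φ ∉ F ∧ ∀ ψ, ψ ∉ F → ψ.imp φ ∈ F := by
  obtain ⟨F, -, hF⟩ := zorn_subset_nonempty {F : Set Formula | IsTh F ∧ φ ∉ F} (by
    intro c hc hch hne
    refine ⟨⋃₀ c, ⟨⟨?_, ?_⟩, ?_⟩, fun s hs => Set.subset_sUnion_of_mem hs⟩
    · intro χ hχ
      obtain ⟨s, hs⟩ := hne
      exact ⟨s, hs, (hc hs).1.thm _ hχ⟩
    · rintro χ θ ⟨s, hs, h1⟩ ⟨t, ht, h2⟩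
      rcases hch.total hs ht with h | h
      · exact ⟨t, ht, (hc ht).1.mp _ _ (h h1) h2⟩
      · exact ⟨s, hs, (hc hs).1.mp _ _ h1 (h h2)⟩
    · rintro ⟨s, hs, h1⟩
      exact (hc hs).2 h1) {χ | Pv χ} ⟨⟨fun _ h => h, fun _ _ h1 h2 => .mp h1 h2⟩, hφ⟩
  refine ⟨F, hF.prop.1, hF.prop.2, fun ψ hψ => ?_⟩
  by_contra hc
  have hT := hF.prop.1
  have := hF.le_of_ge (y := {χ | ψ.imp χ ∈ F}) ⟨hT.exten ψ, hc⟩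
    (fun χ hχ => hT.mp _ _ (hT.lg (.imp1 χ ψ)) hχ)
  apply hψ
  apply this
  exact hT.mp _ _ (hT.mp _ _ (hT.lg (.imp2 ψ (ψ.imp ψ) ψ)) (hT.lg (.imp1 _ _))) (hT.lg (.imp1 _ _))

theorem complete {φ : Formula} (h : ∀ M : MT, M.S φ) : Pv φ := by
  by_contra hφ
  obtain ⟨F, hT, hn, hm⟩ := exists_max φ hφ
  have hcons : ∀ ψ, ψ ∈ F → ψ.neg ∉ F := fun ψ h1 h2 =>
    hn (hT.mp _ _ (hT.mp _ _ (hT.lg (.negE ψ φ)) h2) h1)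
  have hmax : ∀ ψ, ψ ∉ F → ψ.neg ∈ F := by
    intro ψ h1
    by_contra h2
    have h3 := hm _ h1
    have h4 := hm _ h2
    have h5 := hm _ hn
    by_cases h6 : φ.neg ∈ F
    · -- F is consistent: from ψ → φ and ¬φ derive ¬ψ
      have h7 : ψ.imp φ.neg ∈ F := hT.mp _ _ (hT.lg (.imp1 _ _)) h6
      exact h2 (hT.mp _ _ (hT.mp _ _ (hT.lg (.negI ψ φ)) h3) h7)
    · have h8 := hm _ h6
      -- from ¬φ → φ derive ¬¬φ
      have h9 : φ.neg.imp φ.neg ∈ F :=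
        hT.mp _ _ (hT.mp _ _ (hT.lg (.imp2 φ.neg (φ.neg.imp φ.neg) φ.neg)) (hT.lg (.imp1 _ _)))
          (hT.lg (.imp1 _ _))
      have h10 := hT.mp _ _ (hT.mp _ _ (hT.lg (.negI φ.neg φ)) h8) h9
      exact hn (hT.mp _ _ (hT.lg (.dne φ)) h10)
  have himp : ∀ a b : Formula, a.imp b ∈ F ↔ (a ∈ F → b ∈ F) := by
    intro a b
    refine ⟨fun h => hT.mp _ _ h, fun h => ?_⟩
    by_cases ha : a ∈ F
    · exact hT.mp _ _ (hT.lg (.imp1 b a)) (h ha)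
    · exact hT.mp _ _ (hT.lg (.negE a b)) (hmax a ha)
  refine hn (h ⟨fun ψ => ψ ∈ F, fun {φ} h => hT.thm _ h, himp, ?_, ?_, ?_, ?_⟩)
  · intro a b
    exact ⟨fun h => ⟨hT.mp _ _ (hT.lg (.andE1 a b)) h, hT.mp _ _ (hT.lg (.andE2 a b)) h⟩,
      fun h => hT.mp _ _ (hT.mp _ _ (hT.lg (.andI a b)) h.1) h.2⟩
  · intro a b
    refine ⟨fun h => ?_, fun h => h.elim (hT.mp _ _ (hT.lg (.orI1 a b))) (hT.mp _ _ (hT.lg (.orI2 a b)))⟩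
    by_contra hc
    push Not at hc
    have h1 : a.imp φ ∈ F := hm _ hc.1
    have h2 : b.imp φ ∈ F := hm _ hc.2
    exact hn (hT.mp _ _ (hT.mp _ _ (hT.mp _ _ (hT.lg (.orE a b φ)) h1) h2) h)
  · intro a
    exact ⟨fun h h1 => hcons _ h1 h, hmax a⟩
  · intro h
    exact hn (hT.mp _ _ (hT.lg (.falsumE φ)) h)

/-! Substitution lemmas -/

theorem term_substAll_id (t : Term) (v : ℕ → Term) (h : ∀ x ∈ t.fv, v x = .var x) :
    t.substAll v = t := by
  induction t <;> simp_all [Term.substAll, Term.fv]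

theorem substAll_id (φ : Formula) (v : ℕ → Term) (h : ∀ x ∈ φ.fv, v x = .var x) :
    φ.substAll v = φ := by
  induction φ generalizing v with
  | falsum => rfl
  | eq t u =>
    simp only [Formula.fv, Finset.mem_union] at h
    simp only [Formula.substAll]
    rw [term_substAll_id t v (fun x hx => h x (Or.inl hx)), term_substAll_id u v (fun x hx => h x (Or.inr hx))]
  | le t u =>
    simp only [Formula.fv, Finset.mem_union] at h
    simp only [Formula.substAll]
    rw [term_substAll_id t v (fun x hx => h x (Or.inl hx)), term_substAll_id u v (fun x hx => h x (Or.inr hx))]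
  | and a b iha ihb | or a b iha ihb | imp a b iha ihb =>
    simp only [Formula.fv, Finset.mem_union] at h
    simp only [Formula.substAll]
    rw [iha v (fun x hx => h x (Or.inl hx)), ihb v (fun x hx => h x (Or.inr hx))]
  | neg a ih | box a ih => simp only [Formula.substAll]; rw [ih v h]
  | all x a ih | ex x a ih =>
    simp only [Formula.substAll]
    rw [ih]
    intro y hy
    by_cases hxy : y = x
    · subst hxy; simp
    · simp [hxy]; exact h y (by simp [Formula.fv, hy, hxy])

theorem subst_var (x : ℕ) (φ : Formula) : φ.subst x (.var x) = φ := by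
  apply substAll_id; intro y _; simp

theorem subst_notMem {x : ℕ} {s : Term} {φ : Formula} (h : x ∉ φ.fv) : φ.subst x s = φ := by
  apply substAll_id; intro y hy
  rw [Function.update_of_ne]; rintro rfl; exact h hy

theorem term_subst_notMem {x : ℕ} {s : Term} {t : Term} (h : x ∉ t.fv) : Term.subst x s t = t := by
  apply term_substAll_id; intro y hy
  rw [Function.update_of_ne]; rintro rfl; exact h hy

theorem freeFor_var (x : ℕ) (φ : Formula) : φ.freeFor (.var x) x := by
  induction φ <;> simp_all [Formula.freeFor, Term.fv]
  all_goals tauto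

/-! Quantifier and box rules -/

theorem mp {φ ψ : Formula} (h : Pv (φ.imp ψ)) (h' : Pv φ) : Pv ψ := .mp h h'

theorem all_self (x : ℕ) (φ : Formula) : Pv ((Formula.all x φ).imp φ) := by
  have := LogicalAxiom.allE x (.var x) φ (freeFor_var x φ)
  rw [subst_var] at this
  exact .logic this

theorem ex_self (x : ℕ) (φ : Formula) : Pv (φ.imp (Formula.ex x φ)) := by
  have := LogicalAxiom.exI x (.var x) φ (freeFor_var x φ)
  rw [subst_var] at this
  exact .logic this

theorem all_intro {x : ℕ} {A φ : Formula} (hx : x ∉ A.fv) (h : Pv (A.imp φ)) :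
    Pv (A.imp (.all x φ)) := .mp (.logic (.allImp x A φ hx)) (.gen x h)

theorem ex_elim {x : ℕ} {A φ : Formula} (hx : x ∉ A.fv) (h : Pv (φ.imp A)) :
    Pv ((Formula.ex x φ).imp A) := .mp (.logic (.exE x φ A hx)) (.gen x h)

theorem K (φ ψ : Formula) : Pv ((Formula.box (φ.imp ψ)).imp ((Formula.box φ).imp (Formula.box ψ))) :=
  .ax (Or.inr ⟨φ, ψ, rfl⟩)

theorem box1 {φ ψ : Formula} (h : Pv (φ.imp ψ)) : Pv (φ.box.imp ψ.box) := mp (K _ _) (.nec h)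

theorem box2 {φ ψ χ : Formula} (h : Pv (φ.imp (ψ.imp χ))) :
    Pv (φ.box.imp (ψ.box.imp χ.box)) := complete fun M => by
  have h1 := M.thm (box1 h)
  have h2 := M.thm (K ψ χ)
  simp at *; tauto

theorem ind (x : ℕ) (φ : Formula) (h0 : Pv (φ.subst x .zero))
    (hs : Pv (φ.imp (φ.subst x (.succ (.var x))))) : Pv φ := by
  have h1 : Pv (inductionAx x φ) := .ax (Or.inl (Or.inr ⟨x, φ, rfl⟩))
  refine mp (all_self x φ) (mp h1 (complete fun M => ?_))
  have a := M.thm h0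
  have b := M.thm (Provable.gen x hs)
  simp [a, b]

theorem cas (x : ℕ) (φ : Formula) (h0 : Pv (φ.subst x .zero))
    (hs : Pv (φ.subst x (.succ (.var x)))) : Pv φ :=
  ind x φ h0 (complete fun M => by have := M.thm hs; simp [this])

/-! Simultaneous instantiation for quantifier-free formulas -/

/-- Quantifier-free formulas. -/
def qf : Formula → Prop
  | .falsum => True
  | .eq _ _ => True
  | .le _ _ => True
  | .and φ ψ => qf φ ∧ qf ψ
  | .or φ ψ => qf φ ∧ qf ψ
  | .imp φ ψ => qf φ ∧ qf ψ
  | .neg φ => qf φ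
  | .all _ _ => False
  | .ex _ _ => False
  | .box φ => qf φ

theorem qf.freeFor {φ : Formula} (h : qf φ) (s : Term) (x : ℕ) : φ.freeFor s x := by
  induction φ <;> simp_all [qf, Formula.freeFor]

theorem qf.substAll {φ : Formula} (h : qf φ) (v : ℕ → Term) : qf (φ.substAll v) := by
  induction φ <;> simp_all [qf, Formula.substAll]

theorem term_comp (t : Term) (v w u : ℕ → Term) (h : ∀ x ∈ t.fv, (v x).substAll w = u x) :
    (t.substAll v).substAll w = t.substAll u := by
  induction t <;> simp_all [Term.substAll, Term.fv]

theorem qf.comp {φ : Formula} (hq : qf φ) (v w u : ℕ → Term)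
    (h : ∀ x ∈ φ.fv, (v x).substAll w = u x) :
    (φ.substAll v).substAll w = φ.substAll u := by
  induction φ with
  | falsum => rfl
  | eq t s | le t s =>
    simp only [Formula.fv, Finset.mem_union] at h
    simp only [Formula.substAll]
    rw [term_comp t v w u (fun x hx => h x (Or.inl hx)), term_comp s v w u (fun x hx => h x (Or.inr hx))]
  | and a b iha ihb | or a b iha ihb | imp a b iha ihb =>
    simp only [Formula.fv, Finset.mem_union] at h
    simp only [Formula.substAll]
    rw [iha hq.1 (fun x hx => h x (Or.inl hx)), ihb hq.2 (fun x hx => h x (Or.inr hx))]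
  | neg a ih | box a ih => simp only [Formula.substAll]; rw [ih hq h]
  | all x a ih | ex x a ih => exact hq.elim

theorem inst1 {φ : Formula} (hq : qf φ) (h : Pv φ) (x : ℕ) (t : Term) : Pv (φ.subst x t) :=
  mp (.logic (.allE x t φ (hq.freeFor t x))) (.gen x h)

theorem inst_aux (S : Finset ℕ) : ∀ (φ : Formula), qf φ → Pv φ → ∀ v : ℕ → Term,
    (∀ x, x ∉ S → v x = .var x) → (∀ x ∈ S, ∀ y ∈ (v x).fv, y ∉ S) → Pv (φ.substAll v) := by
  induction S using Finset.induction_on with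
  | empty =>
    intro φ hq h v hv _
    rw [substAll_id φ v (fun x _ => hv x (by simp))]; exact h
  | insert a S ha ih =>
    intro φ hq h v hv hv2
    have h1 := ih φ hq h (Function.update v a (.var a)) (by
      intro x hx
      by_cases hxa : x = a
      · subst hxa; simp
      · simp [hxa]; exact hv x (by simp [hx, hxa])) (by
      intro x hx y hy
      have hxa : x ≠ a := by rintro rfl; exact ha hx
      simp [hxa] at hy
      have := hv2 x (by simp [hx]) y hy
      simp at this; exact this.2)
    have h2 := inst1 (hq.substAll _) h1 a (v a)
    unfold Formula.subst at h2
    rw [hq.comp _ _ v] at h2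
    · exact h2
    · intro x _
      by_cases hxa : x = a
      · subst hxa; simp [Term.substAll]
      · simp only [ne_eq, hxa, not_false_eq_true, Function.update_of_ne]
        by_cases hxS : x ∈ S
        · apply term_substAll_id
          intro y hy
          have := hv2 x (by simp [hxS]) y hy
          simp at this
          simp [this.1]
        · rw [hv x (by simp [hxS, hxa])]
          simp [Term.substAll, hxa]

theorem inst {φ : Formula} (hq : qf φ) (h : Pv φ) (v : ℕ → Term) : Pv (φ.substAll v) := by
  classical
  obtain ⟨N, hN⟩ : ∃ N, ∀ y ∈ φ.fv ∪ φ.fv.biUnion (fun x => (v x).fv), y < N :=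
    ⟨(φ.fv ∪ φ.fv.biUnion (fun x => (v x).fv)).sup id + 1, fun y hy =>
      Nat.lt_succ_of_le (Finset.le_sup (f := id) hy)⟩
  have hN1 : ∀ y ∈ φ.fv, y < N := fun y hy => hN y (by simp [hy])
  have hN2 : ∀ x ∈ φ.fv, ∀ y ∈ (v x).fv, y < N := fun x hx y hy => hN y (by
    simp only [Finset.mem_union, Finset.mem_biUnion]; exact Or.inr ⟨x, hx, hy⟩)
  have h1 := inst_aux φ.fv φ hq h (fun x => if x ∈ φ.fv then .var (x + N) else .var x)
    (by intro x hx; simp [hx]) (by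
      intro x hx y hy hy2
      simp [hx, Term.fv] at hy
      have := hN1 y hy2
      omega)
  have h2 := inst_aux (φ.fv.image (· + N)) _ (hq.substAll _) h1
    (fun x => if x ∈ φ.fv.image (· + N) then v (x - N) else .var x)
    (by intro x hx; rw [if_neg hx]) (by
      intro x hx y hy hy2
      rw [if_pos hx] at hy
      simp only [Finset.mem_image] at hx hy2
      obtain ⟨a, ha, rfl⟩ := hx
      obtain ⟨b, hb, rfl⟩ := hy2
      have := hN2 a ha _ (by simpa using hy)
      omega)
  rw [hq.comp _ _ v] at h2
  · exact h2
  · intro x hx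
    simp [hx, Term.substAll]

/-! Equality inside maximal theories -/

theorem MT.lg (M : MT) {φ : Formula} (h : LogicalAxiom φ) : M.S φ := M.thm (.logic h)

theorem MT.refl (M : MT) (t : Term) : M.S (.eq t t) := M.lg (.eqRefl t)

theorem MT.symm (M : MT) {t u : Term} (h : M.S (.eq t u)) : M.S (.eq u t) := by
  have := M.lg (.eqSymm t u)
  rw [M.imp] at this; exact this h

theorem MT.trans (M : MT) {t u w : Term} (h : M.S (.eq t u)) (h' : M.S (.eq u w)) :
    M.S (.eq t w) := by
  have := M.lg (.eqTrans t u w)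
  rw [M.imp, M.imp] at this; exact this h h'

theorem MT.succ (M : MT) {t u : Term} (h : M.S (.eq t u)) : M.S (.eq t.succ u.succ) := by
  have := M.lg (.eqSucc t u)
  rw [M.imp] at this; exact this h

theorem MT.add (M : MT) {t u t' u' : Term} (h : M.S (.eq t u)) (h' : M.S (.eq t' u')) :
    M.S (.eq (t.add t') (u.add u')) := by
  have := M.lg (.eqAdd t u t' u')
  rw [M.imp, M.imp] at this; exact this h h'

theorem MT.mul (M : MT) {t u t' u' : Term} (h : M.S (.eq t u)) (h' : M.S (.eq t' u')) :
    M.S (.eq (t.mul t') (u.mul u')) := by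
  have := M.lg (.eqMul t u t' u')
  rw [M.imp, M.imp] at this; exact this h h'

theorem MT.le (M : MT) {t u t' u' : Term} (h : M.S (.eq t u)) (h' : M.S (.eq t' u'))
    (hl : M.S (.le t t')) : M.S (.le u u') := by
  have := M.lg (.eqLe t u t' u')
  rw [M.imp, M.imp, M.imp] at this; exact this h h' hl

/-! Basic arithmetic -/

/-- A valuation sending 0, 1, and everything else to the given terms. -/
def vv (a b c : Term) : ℕ → Term
  | 0 => a
  | 1 => b
  | _ => c

theorem base {φ : Formula} (h : φ ∈ baseAxioms) : Pv φ := .ax (Or.inl (Or.inl h))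

theorem succ_ne_zero (t : Term) : Pv (Formula.eq t.succ .zero).neg := by
  have := inst (φ := succNeZero) (by simp [succNeZero, qf]) (base (by simp [baseAxioms])) (vv t t t)
  simpa [succNeZero, Formula.substAll, Term.substAll, vv] using this

theorem succ_inj (t u : Term) : Pv ((Formula.eq t.succ u.succ).imp (.eq t u)) := by
  have := inst (φ := succInj) (by simp [succInj, qf]) (base (by simp [baseAxioms])) (vv t u u)
  simpa [succInj, Formula.substAll, Term.substAll, vv] using this

theorem add_zero' (t : Term) : Pv (Formula.eq (t.add .zero) t) := by
  have := inst (φ := addZero) (by simp [addZero, qf]) (base (by simp [baseAxioms])) (vv t t t)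
  simpa [addZero, Formula.substAll, Term.substAll, vv] using this

theorem add_succ' (t u : Term) : Pv (Formula.eq (t.add u.succ) (t.add u).succ) := by
  have := inst (φ := addSucc) (by simp [addSucc, qf]) (base (by simp [baseAxioms])) (vv t u u)
  simpa [addSucc, Formula.substAll, Term.substAll, vv] using this

theorem le_def : Pv leDef := base (by simp [baseAxioms])

theorem le_intro (t u w : Term) : Pv ((Formula.eq (t.add w) u).imp (.le t u)) := by
  have h : Pv ((Formula.eq ((Term.var 0).add (.var 2)) (.var 1)).imp (.le (.var 0) (.var 1))) :=
    complete fun M => by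
      have h1 := M.thm le_def
      have h2 := M.thm (ex_self 2 (Formula.eq ((Term.var 0).add (.var 2)) (.var 1)))
      simp [leDef] at *
      tauto
  have := inst (by simp [qf]) h (vv t u w)
  simpa [Formula.substAll, Term.substAll, vv] using this

/-- Elimination of `≤` between the variables 0 and 1. -/
theorem le_elim {A : Formula} (hA : 2 ∉ A.fv)
    (h : Pv ((Formula.eq ((Term.var 0).add (.var 2)) (.var 1)).imp A)) :
    Pv ((Formula.le (.var 0) (.var 1)).imp A) := by
  have h2 := ex_elim hA h
  exact complete fun M => by
    have h1 := M.thm le_def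
    have h2 := M.thm h2
    simp [leDef] at *
    tauto

theorem zero_add' (t : Term) : Pv (Formula.eq (Term.zero.add t) t) := by
  have h : Pv (Formula.eq (Term.zero.add (.var 0)) (.var 0)) := by
    apply ind 0
    · exact add_zero' _
    · exact complete fun M => by
        rw [M.imp]; intro h
        exact M.trans (M.thm (add_succ' _ _)) (M.succ h)
  have := inst (by simp [qf]) h (vv t t t)
  simpa [Formula.substAll, Term.substAll, vv] using this

theorem succ_add' (t u : Term) : Pv (Formula.eq (t.succ.add u) (t.add u).succ) := by
  have h : Pv (Formula.eq ((Term.var 0).succ.add (.var 1)) ((Term.var 0).add (.var 1)).succ) := by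
    apply ind 1
    · exact complete fun M =>
        M.trans (M.thm (add_zero' _)) (M.succ (M.symm (M.thm (add_zero' _))))
    · exact complete fun M => by
        rw [M.imp]; intro h
        exact M.trans (M.thm (add_succ' _ _))
          (M.trans (M.succ h) (M.succ (M.symm (M.thm (add_succ' _ _)))))
  have := inst (by simp [qf]) h (vv t u u)
  simpa [Formula.substAll, Term.substAll, vv] using this

theorem zero_le' (t : Term) : Pv (Formula.le .zero t) := mp (le_intro _ _ t) (zero_add' t)

theorem not_succ_le_zero (t : Term) : Pv (Formula.le t.succ .zero).neg := by
  have h0 : Pv ((Formula.eq ((Term.var 0).add (.var 2)) (.var 1)).imp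
      ((Formula.eq (.var 0) (Term.var 3).succ).imp (Formula.eq (.var 1) .zero).neg)) := by
    apply cas 2
    · exact complete fun M => by
        simp [Formula.substAll, Formula.subst, Term.substAll]
        intro h1 h2 h3
        have := M.thm (succ_ne_zero (.var 3))
        rw [M.neg] at this
        exact this (M.trans (M.symm h2) (M.trans (M.symm (M.thm (add_zero' _))) (M.trans h1 h3)))
    · exact complete fun M => by
        simp [Formula.substAll, Formula.subst, Term.substAll]
        intro h1 h2 h3
        have := M.thm (succ_ne_zero ((Term.var 0).add (.var 2)))
        rw [M.neg] at this
        exact this (M.trans (M.symm (M.thm (add_succ' _ _))) (M.trans h1 h3))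
  have h1 := le_elim (by decide) h0
  have h2 := inst (by simp [qf]) h1 (fun n => if n = 0 then t.succ else if n = 3 then t else .zero)
  simp [Formula.substAll, Term.substAll] at h2
  exact complete fun M => by
    have := M.thm h2
    have a := M.refl t.succ
    have b := M.refl .zero
    simp at *; tauto

theorem succ_le_succ' (t u : Term) : Pv ((Formula.le t u).imp (.le t.succ u.succ)) := by
  have h0 : Pv ((Formula.le (.var 0) (.var 1)).imp (.le (Term.var 0).succ (Term.var 1).succ)) := by
    apply le_elim (by decide)
    exact complete fun M => by
      rw [M.imp]; intro h
      have := M.thm (le_intro (Term.var 0).succ (Term.var 1).succ (.var 2))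
      rw [M.imp] at this
      exact this (M.trans (M.thm (succ_add' _ _)) (M.succ h))
  have := inst (by simp [qf]) h0 (vv t u u)
  simpa [Formula.substAll, Term.substAll, vv] using this

theorem le_succ_self_of_le (t u : Term) : Pv ((Formula.le t u).imp (.le t u.succ)) := by
  have h0 : Pv ((Formula.le (.var 0) (.var 1)).imp (.le (Term.var 0) (Term.var 1).succ)) := by
    apply le_elim (by decide)
    exact complete fun M => by
      rw [M.imp]; intro h
      have := M.thm (le_intro (Term.var 0) (Term.var 1).succ (Term.var 2).succ)
      rw [M.imp] at this
      exact this (M.trans (M.thm (add_succ' _ _)) (M.succ h))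
  have := inst (by simp [qf]) h0 (vv t u u)
  simpa [Formula.substAll, Term.substAll, vv] using this

theorem le_refl' (t : Term) : Pv (Formula.le t t) := mp (le_intro _ _ .zero) (add_zero' t)

theorem le_of_succ_le_succ' (t u : Term) : Pv ((Formula.le t.succ u.succ).imp (.le t u)) := by
  have h0 : Pv ((Formula.le (.var 0) (.var 1)).imp
      ((Formula.eq (.var 0) (Term.var 3).succ).imp ((Formula.eq (.var 1) (Term.var 4).succ).imp
        (.le (Term.var 3) (Term.var 4))))) := by
    apply le_elim (by decide)
    exact complete fun M => by
      simp only [M.imp]; intro h h3 h4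
      have := M.thm (le_intro (Term.var 3) (Term.var 4) (Term.var 2))
      rw [M.imp] at this
      apply this
      have := M.thm (succ_inj ((Term.var 3).add (.var 2)) (.var 4))
      rw [M.imp] at this
      apply this
      exact M.trans (M.symm (M.thm (succ_add' _ _)))
        (M.trans (M.add (M.symm h3) (M.refl _)) (M.trans h h4))
  have h2 := inst (by simp [qf]) h0 (fun n => if n = 0 then t.succ else if n = 3 then t else
    if n = 1 then u.succ else u)
  simp [Formula.substAll, Term.substAll] at h2
  exact complete fun M => by
    have := M.thm h2
    have a := M.refl t.succ
    have b := M.refl u.succ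
    simp at *; tauto

theorem le_cases (t u : Term) : Pv ((Formula.le t u).imp ((Formula.le t.succ u).or (.eq t u))) := by
  have h0 : Pv ((Formula.le (.var 0) (.var 1)).imp
      ((Formula.le (Term.var 0).succ (.var 1)).or (.eq (.var 0) (.var 1)))) := by
    apply le_elim (by decide)
    apply cas 2
    · exact complete fun M => by
        simp [Formula.substAll, Formula.subst, Term.substAll]
        intro h1
        exact Or.inr (M.trans (M.symm (M.thm (add_zero' _))) h1)
    · exact complete fun M => by
        simp [Formula.substAll, Formula.subst, Term.substAll]
        intro h1
        have := M.thm (le_intro (Term.var 0).succ (.var 1) (Term.var 2))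
        rw [M.imp] at this
        exact Or.inl (this (M.trans (M.thm (succ_add' _ _))
          (M.trans (M.symm (M.thm (add_succ' _ _))) h1)))
  have := inst (by simp [qf]) h0 (vv t u u)
  simpa [Formula.substAll, Term.substAll, vv] using this

/-! Atomic formulas and their negations imply their boxes -/

/-- `φ` is stable. -/
abbrev Stab (φ : Formula) : Prop := Pv (φ.imp φ.box)

theorem stab_of_pv {φ : Formula} (h : Pv φ) : Stab φ := complete fun M => by
  have := M.thm (Provable.nec h)
  simp [this]

theorem stab_of_not {φ : Formula} (h : Pv φ.neg) : Stab φ := complete fun M => by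
  have := M.thm h
  simp at *; simp [this]

theorem eq_stab (t u : Term) : Stab (.eq t u) := by
  have h : Pv (Formula.all 1 ((Formula.eq (.var 0) (.var 1)).imp
      (Formula.eq (.var 0) (.var 1)).box)) := by
    apply ind 0
    · apply Provable.gen
      apply cas 1
      · exact stab_of_pv (.logic (.eqRefl _))
      · refine stab_of_not (complete fun M => ?_)
        have := M.thm (succ_ne_zero (.var 1))
        simp at *
        exact fun h => this (M.symm h)
    · apply all_intro (by decide)
      apply cas 1
      · exact complete fun M => by
          simp [Formula.substAll, Formula.subst, Term.substAll]
          intro _ h1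
          have := M.thm (succ_ne_zero (.var 0))
          simp at this
          exact (this h1).elim
      · exact complete fun M => by
          have h1 := M.thm (all_self 1 ((Formula.eq (.var 0) (.var 1)).imp
            (Formula.eq (.var 0) (.var 1)).box))
          have h2 := M.thm (succ_inj (.var 0) (.var 1))
          have h3 := M.thm (box1 (Provable.logic (.eqSucc (.var 0) (.var 1))))
          simp [Formula.substAll, Formula.subst, Term.substAll] at *
          tauto
  have := inst (by simp [qf]) (mp (all_self _ _) h) (vv t u u)
  simpa [Formula.substAll, Term.substAll, vv] using this

theorem ne_stab (t u : Term) : Stab (Formula.eq t u).neg := by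
  have h : Pv (Formula.all 1 ((Formula.eq (.var 0) (.var 1)).neg.imp
      (Formula.eq (.var 0) (.var 1)).neg.box)) := by
    apply ind 0
    · apply Provable.gen
      apply cas 1
      · refine stab_of_not (complete fun M => ?_)
        have := M.refl .zero
        simpa [Formula.substAll, Formula.subst, Term.substAll] using this
      · refine stab_of_pv (complete fun M => ?_)
        have := M.thm (succ_ne_zero (.var 1))
        simp [Formula.substAll, Formula.subst, Term.substAll] at *
        exact fun h => this (M.symm h)
    · apply all_intro (by decide)
      apply cas 1
      · have h1 := stab_of_pv (succ_ne_zero (.var 0))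
        exact complete fun M => by
          have h1 := M.thm h1
          simp [Formula.substAll, Formula.subst, Term.substAll] at *
          tauto
      · have h3 : Pv ((Formula.eq (.var 0) (.var 1)).neg.imp
            (Formula.eq (Term.var 0).succ (Term.var 1).succ).neg) := complete fun M => by
          have := M.thm (succ_inj (.var 0) (.var 1))
          simp at *; tauto
        exact complete fun M => by
          have h1 := M.thm (all_self 1 ((Formula.eq (.var 0) (.var 1)).neg.imp
            (Formula.eq (.var 0) (.var 1)).neg.box))
          have h2 := M.lg (.eqSucc (.var 0) (.var 1))
          have h3 := M.thm (box1 h3)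
          simp [Formula.substAll, Formula.subst, Term.substAll] at *
          tauto
  have := inst (by simp [qf]) (mp (all_self _ _) h) (vv t u u)
  simpa [Formula.substAll, Term.substAll, vv] using this

theorem le_stab (t u : Term) : Stab (.le t u) := by
  have h : Pv ((Formula.le (.var 0) (.var 1)).imp (Formula.le (.var 0) (.var 1)).box) := by
    apply le_elim (by decide)
    exact complete fun M => by
      have h1 := M.thm (eq_stab ((Term.var 0).add (.var 2)) (.var 1))
      have h2 := M.thm (box1 (le_intro (.var 0) (.var 1) (.var 2)))
      simp at *; tauto
  have := inst (by simp [qf]) h (vv t u u)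
  simpa [Formula.substAll, Term.substAll, vv] using this

theorem nle_stab (t u : Term) : Stab (Formula.le t u).neg := by
  have h : Pv (Formula.all 1 ((Formula.le (.var 0) (.var 1)).neg.imp
      (Formula.le (.var 0) (.var 1)).neg.box)) := by
    apply ind 0
    · apply Provable.gen
      refine stab_of_not (complete fun M => ?_)
      have := M.thm (zero_le' (.var 1))
      simpa [Formula.substAll, Formula.subst, Term.substAll] using this
    · apply all_intro (by decide)
      apply cas 1
      · have h1 := stab_of_pv (not_succ_le_zero (.var 0))
        exact complete fun M => by
          have h1 := M.thm h1
          simp [Formula.substAll, Formula.subst, Term.substAll] at *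
          tauto
      · have h3 : Pv ((Formula.le (.var 0) (.var 1)).neg.imp
            (Formula.le (Term.var 0).succ (Term.var 1).succ).neg) := complete fun M => by
          have := M.thm (le_of_succ_le_succ' (.var 0) (.var 1))
          simp at *; tauto
        exact complete fun M => by
          have h1 := M.thm (all_self 1 ((Formula.le (.var 0) (.var 1)).neg.imp
            (Formula.le (.var 0) (.var 1)).neg.box))
          have h2 := M.thm (succ_le_succ' (.var 0) (.var 1))
          have h3 := M.thm (box1 h3)
          simp [Formula.substAll, Formula.subst, Term.substAll] at *
          tauto
  have := inst (by simp [qf]) (mp (all_self _ _) h) (vv t u u)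
  simpa [Formula.substAll, Term.substAll, vv] using this

/-! Bounded quantification -/

/-- All bound variables of a formula. -/
def bv : Formula → Finset ℕ
  | .falsum => ∅
  | .eq _ _ => ∅
  | .le _ _ => ∅
  | .and φ ψ => bv φ ∪ bv ψ
  | .or φ ψ => bv φ ∪ bv ψ
  | .imp φ ψ => bv φ ∪ bv ψ
  | .neg φ => bv φ
  | .all x φ => insert x (bv φ)
  | .ex x φ => insert x (bv φ)
  | .box φ => bv φ

theorem notMem_term_subst (x : ℕ) (s t : Term) (h : x ∉ s.fv) : x ∉ (Term.subst x s t).fv := by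
  unfold Term.subst
  induction t with
  | var z =>
    by_cases hz : z = x
    · subst hz; simpa [Term.substAll] using h
    · simp [Term.substAll, Function.update_of_ne hz, Term.fv]; exact fun h => hz h.symm
  | zero => simp [Term.substAll, Term.fv]
  | succ t ih => simpa [Term.substAll, Term.fv] using ih
  | add t u iht ihu => simp only [Term.substAll, Term.fv, Finset.mem_union]; tauto
  | mul t u iht ihu => simp only [Term.substAll, Term.fv, Finset.mem_union]; tauto

theorem MT.term_leib (M : MT) (x : ℕ) (s t : Term) (h : M.S (.eq (.var x) s)) :
    M.S (.eq t (Term.subst x s t)) := by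
  unfold Term.subst
  induction t with
  | var z =>
    by_cases hz : z = x
    · subst hz; simpa [Term.substAll] using h
    · simp [Term.substAll, Function.update_of_ne hz]; exact M.refl _
  | zero => exact M.refl _
  | succ t ih => exact M.succ ih
  | add t u iht ihu => exact M.add iht ihu
  | mul t u iht ihu => exact M.mul iht ihu

/-- Under the assumption `x = y`, the formula is equivalent to one in which `x` is not free. -/
theorem leib (x y : ℕ) (hxy : x ≠ y) (φ : Formula) (hb : φ.noBox) (hy : y ∉ bv φ) :
    ∃ A : Formula, x ∉ A.fv ∧ Pv ((Formula.eq (.var x) (.var y)).imp (φ.iff A)) := by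
  have hxv : x ∉ (Term.var y).fv := by simpa [Term.fv] using hxy
  induction φ with
  | falsum => exact ⟨.falsum, by simp [Formula.fv], complete fun M => by simp⟩
  | eq t u =>
    refine ⟨.eq (Term.subst x (.var y) t) (Term.subst x (.var y) u), ?_, complete fun M => ?_⟩
    · simp only [Formula.fv, Finset.mem_union, not_or]
      exact ⟨notMem_term_subst _ _ _ hxv, notMem_term_subst _ _ _ hxv⟩
    · rw [M.imp, M.iff]
      intro h
      have ht := M.term_leib x _ t h
      have hu := M.term_leib x _ u h
      exact ⟨fun k => M.trans (M.symm ht) (M.trans k hu), fun k => M.trans ht (M.trans k (M.symm hu))⟩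
  | le t u =>
    refine ⟨.le (Term.subst x (.var y) t) (Term.subst x (.var y) u), ?_, complete fun M => ?_⟩
    · simp only [Formula.fv, Finset.mem_union, not_or]
      exact ⟨notMem_term_subst _ _ _ hxv, notMem_term_subst _ _ _ hxv⟩
    · rw [M.imp, M.iff]
      intro h
      have ht := M.term_leib x _ t h
      have hu := M.term_leib x _ u h
      exact ⟨fun k => M.le ht hu k, fun k => M.le (M.symm ht) (M.symm hu) k⟩
  | and a b iha ihb =>
    simp only [bv, Finset.mem_union, not_or] at hy
    obtain ⟨A, hA, hA'⟩ := iha hb.1 hy.1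
    obtain ⟨B, hB, hB'⟩ := ihb hb.2 hy.2
    refine ⟨A.and B, by simp [Formula.fv, hA, hB], complete fun M => ?_⟩
    have h1 := M.thm hA'
    have h2 := M.thm hB'
    simp at h1 h2 ⊢; intro h; rw [h1 h, h2 h]
  | or a b iha ihb =>
    simp only [bv, Finset.mem_union, not_or] at hy
    obtain ⟨A, hA, hA'⟩ := iha hb.1 hy.1
    obtain ⟨B, hB, hB'⟩ := ihb hb.2 hy.2
    refine ⟨A.or B, by simp [Formula.fv, hA, hB], complete fun M => ?_⟩
    have h1 := M.thm hA'
    have h2 := M.thm hB'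
    simp at h1 h2 ⊢; intro h; rw [h1 h, h2 h]
  | imp a b iha ihb =>
    simp only [bv, Finset.mem_union, not_or] at hy
    obtain ⟨A, hA, hA'⟩ := iha hb.1 hy.1
    obtain ⟨B, hB, hB'⟩ := ihb hb.2 hy.2
    refine ⟨A.imp B, by simp [Formula.fv, hA, hB], complete fun M => ?_⟩
    have h1 := M.thm hA'
    have h2 := M.thm hB'
    simp at h1 h2 ⊢; intro h; rw [h1 h, h2 h]
  | neg a iha =>
    obtain ⟨A, hA, hA'⟩ := iha hb hy
    refine ⟨A.neg, by simp [Formula.fv, hA], complete fun M => ?_⟩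
    have h1 := M.thm hA'
    simp at h1 ⊢; intro h; rw [h1 h]
  | all w a ih =>
    simp only [bv, Finset.mem_insert, not_or] at hy
    by_cases hw : w = x
    · subst hw
      exact ⟨.all w a, by simp [Formula.fv], complete fun M => by simp⟩
    obtain ⟨A, hA, hA'⟩ := ih hb hy.2
    refine ⟨.all w A, by simp [Formula.fv, hA], ?_⟩
    have h1 : Pv (((Formula.eq (.var x) (.var y)).and (.all w a)).imp (.all w A)) := by
      apply all_intro
      · simp [Formula.fv, Term.fv, hw, Ne.symm hy.1]
      · exact complete fun M => by
          have h1 := M.thm hA'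
          have h2 := M.thm (all_self w a)
          simp at *; tauto
    have h2 : Pv (((Formula.eq (.var x) (.var y)).and (.all w A)).imp (.all w a)) := by
      apply all_intro
      · simp [Formula.fv, Term.fv, hw, Ne.symm hy.1]
      · exact complete fun M => by
          have h1 := M.thm hA'
          have h2 := M.thm (all_self w A)
          simp at *; tauto
    exact complete fun M => by
      have h1 := M.thm h1
      have h2 := M.thm h2
      simp at *; tauto
  | ex w a ih =>
    simp only [bv, Finset.mem_insert, not_or] at hy
    by_cases hw : w = x
    · subst hw
      exact ⟨.ex w a, by simp [Formula.fv], complete fun M => by simp⟩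
    obtain ⟨A, hA, hA'⟩ := ih hb hy.2
    refine ⟨.ex w A, by simp [Formula.fv, hA], ?_⟩
    have h1 : Pv ((Formula.ex w a).imp ((Formula.eq (.var x) (.var y)).imp (.ex w A))) := by
      apply ex_elim
      · simp [Formula.fv, Term.fv, hw, Ne.symm hy.1]
      · exact complete fun M => by
          have h1 := M.thm hA'
          have h2 := M.thm (ex_self w A)
          simp at *; tauto
    have h2 : Pv ((Formula.ex w A).imp ((Formula.eq (.var x) (.var y)).imp (.ex w a))) := by
      apply ex_elim
      · simp [Formula.fv, Term.fv, hw, Ne.symm hy.1]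
      · exact complete fun M => by
          have h1 := M.thm hA'
          have h2 := M.thm (ex_self w a)
          simp at *; tauto
    exact complete fun M => by
      have h1 := M.thm h1
      have h2 := M.thm h2
      simp at *; tauto
  | box a => exact hb.elim

/-- A term always has a value: a formula following from `x = t` with `x` fresh is provable. -/
theorem elim_eq {x : ℕ} {t : Term} {A : Formula} (hx : x ∉ t.fv) (hA : x ∉ A.fv)
    (h : Pv ((Formula.eq (.var x) t).imp A)) : Pv A := by
  have h1 : Pv (((Formula.eq (.var x) t).subst x t).imp (Formula.ex x (.eq (.var x) t))) :=
    .logic (.exI x t _ (by simp [Formula.freeFor]))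
  have h2 : (Formula.eq (.var x) t).subst x t = .eq t t := by
    have := term_subst_notMem (s := t) hx
    unfold Term.subst at this
    simp [Formula.subst, Formula.substAll, Term.substAll, this]
  rw [h2] at h1
  exact mp (ex_elim hA h) (mp h1 (.logic (.eqRefl t)))

theorem ball_fv (x : ℕ) (t : Term) (φ : Formula) :
    (ball x t φ).fv = (({x} ∪ t.fv) ∪ φ.fv).erase x := rfl

theorem ball_self (x : ℕ) (t : Term) (φ : Formula) :
    Pv ((ball x t φ).imp ((Formula.le (Term.var x).succ t).imp φ)) := all_self _ _

theorem ball_var_stab {x y : ℕ} (hxy : x ≠ y) {φ : Formula} (hb : φ.noBox) (hs : Stab φ)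
    (hy : y ∉ bv φ) (hyf : y ∉ φ.fv) : Stab (ball x (.var y) φ) := by
  have hsub : ∀ s : Term, ((ball x (.var y) φ).imp (ball x (.var y) φ).box).subst y s =
      (ball x s φ).imp (ball x s φ).box := by
    intro s
    have h1 : φ.substAll (Function.update (Function.update Term.var y s) x (.var x)) = φ := by
      apply substAll_id
      intro z hz
      have hzy : z ≠ y := by rintro rfl; exact hyf hz
      by_cases hzx : z = x
      · subst hzx; simp
      · simp [hzx, hzy]
    simp [Formula.subst, ball, lt, Formula.substAll, Term.substAll, h1, Ne.symm hxy]
  apply ind y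
  · rw [hsub]
    apply stab_of_pv
    apply Provable.gen
    exact complete fun M => by
      have := M.thm (not_succ_le_zero (.var x))
      simp [lt] at *; tauto
  · rw [hsub]
    obtain ⟨A, hA, hA'⟩ := leib x y hxy φ hb hy
    have hxv : x ∉ (Term.var y).fv := by simpa [Term.fv] using hxy
    have c1 : Pv ((ball x (Term.var y).succ φ).imp A) := by
      apply elim_eq hxv
      · simp [Formula.fv, ball_fv, hA]
      · exact complete fun M => by
          have h1 := M.thm hA'
          have h2 := M.thm (ball_self x (Term.var y).succ φ)
          have h3 := M.thm (le_refl' (Term.var x).succ)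
          simp at *
          intro h4 h5
          exact (h1 h4).1 (h2 h5 (M.le (M.refl _) (M.succ h4) h3))
    have c2 : Stab A := by
      apply elim_eq hxv
      · simp [Formula.fv, hA]
      · have h3 : Pv ((Formula.eq (.var x) (.var y)).imp (φ.imp A)) := complete fun M => by
          have h1 := M.thm hA'
          simp at *; tauto
        exact complete fun M => by
          have h1 := M.thm hA'
          have h2 := M.thm hs
          have h3 := M.thm (box2 h3)
          have h4 := M.thm (eq_stab (.var x) (.var y))
          simp at *; tauto
    have c3 : Pv ((ball x (Term.var y).succ φ).imp (ball x (.var y) φ)) := by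
      apply all_intro
      · simp [ball_fv]
      · exact complete fun M => by
          have h1 := M.thm (le_succ_self_of_le (Term.var x).succ (.var y))
          have h2 := M.thm (ball_self x (Term.var y).succ φ)
          simp [lt] at *; tauto
    have c4 : Pv (((ball x (.var y) φ).and A).imp (ball x (Term.var y).succ φ)) := by
      apply all_intro
      · simp [Formula.fv, ball_fv, hA]
      · exact complete fun M => by
          have h1 := M.thm (le_of_succ_le_succ' (Term.var x) (.var y))
          have h2 := M.thm (le_cases (Term.var x) (.var y))
          have h3 := M.thm (ball_self x (.var y) φ)
          have h4 := M.thm hA'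
          simp [lt] at *; tauto
    have c5 : Pv ((ball x (.var y) φ).imp (A.imp (ball x (Term.var y).succ φ))) :=
      complete fun M => by
        have := M.thm c4
        simp at *; tauto
    exact complete fun M => by
      have c1 := M.thm c1
      have c2 := M.thm c2
      have c3 := M.thm c3
      have c5 := M.thm (box2 c5)
      simp at *; tauto

theorem ball_congr {x : ℕ} {t u : Term} (ht : x ∉ t.fv) (hu : x ∉ u.fv) (φ : Formula) :
    Pv ((Formula.eq t u).imp ((ball x u φ).imp (ball x t φ))) := by
  have h : Pv (((Formula.eq t u).and (ball x u φ)).imp (ball x t φ)) := by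
    apply all_intro
    · simp [Formula.fv, ball_fv, ht, hu]
    · exact complete fun M => by
        have h1 := M.thm (ball_self x u φ)
        simp [lt] at *
        intro h2 h3 h4
        exact h1 h3 (M.le (M.refl _) h2 h4)
  exact complete fun M => by
    have := M.thm h
    simp at *; tauto

theorem ball_stab {x : ℕ} {t : Term} (hx : x ∉ t.fv) {φ : Formula} (hb : φ.noBox) (hs : Stab φ) :
    Stab (ball x t φ) := by
  obtain ⟨y, hy⟩ := Infinite.exists_notMem_finset ({x} ∪ t.fv ∪ φ.fv ∪ bv φ)
  simp only [Finset.mem_union, Finset.mem_singleton, not_or] at hy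
  obtain ⟨⟨⟨h1, h2⟩, h3⟩, h4⟩ := hy
  have hxv : x ∉ (Term.var y).fv := by simpa [Term.fv] using Ne.symm h1
  have key := ball_var_stab (Ne.symm h1) hb hs h4 h3
  refine elim_eq (x := y) (t := t) h2 ?_ ?_
  · simp [Formula.fv, ball_fv, h1, h2, h3]
  · have c1 := ball_congr hxv hx φ
    have c2 : Pv ((Formula.eq (.var y) t).imp ((ball x (.var y) φ).imp (ball x t φ))) :=
      complete fun M => by
        have := M.thm (ball_congr hx hxv φ)
        simp at *
        exact fun h => this (M.symm h)
    exact complete fun M => by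
      have k := M.thm key
      have c1 := M.thm c1
      have c2 := M.thm (box2 c2)
      have c3 := M.thm (eq_stab (.var y) t)
      simp at *; tauto

/-! The main induction -/

theorem and_stab {φ ψ : Formula} (h : Stab φ) (h' : Stab ψ) : Stab (φ.and ψ) :=
  complete fun M => by
    have h := M.thm h
    have h' := M.thm h'
    have := M.thm (box2 (Provable.logic (.andI φ ψ)))
    simp at *; tauto

/-- Stability follows if the formula follows from one of its stable consequences. -/
theorem stab_equiv {φ ψ : Formula} (h : Stab φ) (h1 : Pv (ψ.imp φ)) (h2 : Pv (φ.imp ψ)) :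
    Stab ψ := complete fun M => by
  have h := M.thm h
  have h1 := M.thm h1
  have h2 := M.thm (box1 h2)
  simp at *; tauto

theorem or_stab {φ ψ : Formula} (h : Stab φ) (h' : Stab ψ) : Stab (φ.or ψ) :=
  complete fun M => by
    have h := M.thm h
    have h' := M.thm h'
    have h1 := M.thm (box1 (Provable.logic (.orI1 φ ψ)))
    have h2 := M.thm (box1 (Provable.logic (.orI2 φ ψ)))
    simp at *; tauto

theorem ex_stab {x : ℕ} {φ : Formula} (h : Stab φ) : Stab (.ex x φ) := by
  apply ex_elim
  · simp [Formula.fv]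
  · exact complete fun M => by
      have h := M.thm h
      have h1 := M.thm (box1 (ex_self x φ))
      simp at *; tauto

theorem IsDelta0.noBox' {φ : Formula} (h : IsDelta0 φ) : φ.noBox := by
  induction h with
  | falsum | eq | le => trivial
  | and _ _ h1 h2 | or _ _ h1 h2 | imp _ _ h1 h2 => exact ⟨h1, h2⟩
  | neg _ h => exact h
  | ball _ _ h | bex _ _ h => exact ⟨trivial, h⟩

theorem IsSigma1.noBox' {φ : Formula} (h : IsSigma1 φ) : φ.noBox := by
  induction h with
  | delta0 h => exact h.noBox'
  | and _ _ h1 h2 | or _ _ h1 h2 => exact ⟨h1, h2⟩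
  | ex _ h => exact h
  | ball _ _ h => exact ⟨trivial, h⟩

theorem neg_neg_stab {φ : Formula} (h : Stab φ) : Stab φ.neg.neg :=
  stab_equiv h (complete fun M => by simp) (complete fun M => by simp)

theorem neg_ball_stab {x : ℕ} {t : Term} {φ : Formula} (h : Stab φ.neg) :
    Stab (ball x t φ).neg := by
  have h0 : Pv (((Formula.le (Term.var x).succ t).and φ.neg).imp (ball x t φ).neg) :=
    complete fun M => by
      have := M.thm (ball_self x t φ)
      simp at *; tauto
  have h1 : Pv ((ball x t φ).neg.box.neg.imp (ball x t φ)) := by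
    apply all_intro
    · simp [Formula.fv, ball_fv]
    · exact complete fun M => by
        have h1 := M.thm (and_stab (le_stab (Term.var x).succ t) h)
        have h2 := M.thm (box1 h0)
        simp [lt] at *; tauto
  exact complete fun M => by
    have := M.thm h1
    simp at *; tauto

theorem delta0_stab {φ : Formula} (h : IsDelta0 φ) : Stab φ ∧ Stab φ.neg := by
  induction h with
  | falsum =>
    exact ⟨.logic (.falsumE _), stab_of_pv (complete fun M => by simp)⟩
  | eq t u => exact ⟨eq_stab t u, ne_stab t u⟩
  | le t u => exact ⟨le_stab t u, nle_stab t u⟩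
  | and _ _ iha ihb =>
    refine ⟨and_stab iha.1 ihb.1, stab_equiv (or_stab iha.2 ihb.2) ?_ ?_⟩ <;>
    exact complete fun M => by simp; tauto
  | or _ _ iha ihb =>
    refine ⟨or_stab iha.1 ihb.1, stab_equiv (and_stab iha.2 ihb.2) ?_ ?_⟩ <;>
    exact complete fun M => by simp; try tauto
  | imp _ _ iha ihb =>
    refine ⟨stab_equiv (or_stab iha.2 ihb.1) ?_ ?_, stab_equiv (and_stab iha.1 ihb.2) ?_ ?_⟩ <;>
    exact complete fun M => by simp; try tauto
  | neg _ ih => exact ⟨ih.2, neg_neg_stab ih.1⟩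
  | ball hx hd ih => exact ⟨ball_stab hx hd.noBox' ih.1, neg_ball_stab ih.2⟩
  | @bex x t φ hx hd ih =>
    refine ⟨ex_stab (and_stab (le_stab _ _) ih.1),
      stab_equiv (ball_stab (φ := φ.neg) hx hd.noBox' ih.2) ?_ ?_⟩
    · apply all_intro
      · simp [Formula.fv, bex]
      · exact complete fun M => by
          have := M.thm (ex_self x ((lt (.var x) t).and φ))
          simp [bex] at *; tauto
    · have : Pv ((bex x t φ).imp (ball x t φ.neg).neg) := by
        apply ex_elim
        · simp [Formula.fv, ball_fv]
        · exact complete fun M => by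
            have := M.thm (ball_self x t φ.neg)
            simp [lt] at *; tauto
      exact complete fun M => by
        have := M.thm this
        simp at *; tauto

theorem sigma1_stab {φ : Formula} (h : IsSigma1 φ) : Stab φ := by
  induction h with
  | delta0 h => exact (delta0_stab h).1
  | and _ _ iha ihb => exact and_stab iha ihb
  | or _ _ iha ihb => exact or_stab iha ihb
  | ex _ ih => exact ex_stab ih
  | ball hx hd ih => exact ball_stab hx hd.noBox' ih

/-- Formalized Σ₁-completeness: for every Σ₁ formula φ, PA(K) ⊢ φ → □φ. -/
theorem statement3 (φ : Formula) (h : IsSigma1 φ) :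
    Provable PAK (φ.imp (Formula.box φ)) := by
  exact sigma1_stab h

end ModalArith
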